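/- Let 𝓛 ⊆ (Fin 2 × Bool)* be the language consisting of the reduced words (FreeGroup.toWord w) of all cyclically reduced potentially positive elements w of F₂. Then 𝓛 is not a context-free language. -/

import Mathlib

abbrev F2 := FreeGroup (Fin 2)

def Positive2 (w : F2) : Prop :=
  w ∈ Submonoid.closure (Set.range (FreeGroup.of : Fin 2 → F2))

def PotPos2 (w : F2) : Prop := ∃ φ : F2 ≃* F2, Positive2 (φ w)

def CyclicallyReduced2 (w : F2) : Prop :=
  ∀ x ∈ w.toWord.head?, ∀ y ∈ w.toWord.getLast?, x ≠ (y.1, !y.2)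

/-- The language of reduced words of cyclically reduced potentially positive elements. -/
def ppLanguage : Language (Fin 2 × Bool) :=
  {u | ∃ w : F2, CyclicallyReduced2 w ∧ PotPos2 w ∧ u = w.toWord}

namespace PP

section Pump
variable {T : Type*}

/-- Parse-forest relation for a context-free grammar. -/
inductive Yield (g : ContextFreeGrammar T) : List (Symbol T g.NT) → List T → Prop
  | nil : Yield g [] []
  | term (t : T) {s : List (Symbol T g.NT)} {w : List T} (h : Yield g s w) :
      Yield g (Symbol.terminal t :: s) (t :: w)
  | nont (r : ContextFreeRule T g.NT) (hr : r ∈ g.rules) {s : List (Symbol T g.NT)}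
      {w1 w2 : List T} (h1 : Yield g r.output w1) (h2 : Yield g s w2) :
      Yield g (Symbol.nonterminal r.input :: s) (w1 ++ w2)

variable {g : ContextFreeGrammar T}

lemma Yield.append {s t : List (Symbol T g.NT)} {w v : List T} (h : Yield g s w)
    (h' : Yield g t v) : Yield g (s ++ t) (w ++ v) := by
  induction h with
  | nil => simpa
  | term c h ih => exact Yield.term c ih
  | nont r hr h1 h2 ih1 ih2 =>
    rw [List.append_assoc]
    exact Yield.nont r hr h1 ih2

lemma Yield.split {s t : List (Symbol T g.NT)} {w : List T} (h : Yield g (s ++ t) w) :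
    ∃ w1 w2, w = w1 ++ w2 ∧ Yield g s w1 ∧ Yield g t w2 := by
  induction s generalizing w with
  | nil => exact ⟨[], w, rfl, Yield.nil, h⟩
  | cons c s ih =>
    rw [List.cons_append] at h
    cases h with
    | term c h =>
      obtain ⟨w1, w2, rfl, h1, h2⟩ := ih h
      exact ⟨c :: w1, w2, rfl, Yield.term c h1, h2⟩
    | nont r hr h1 h2 =>
      obtain ⟨w1, w2, rfl, h3, h4⟩ := ih h2
      exact ⟨_ ++ w1, w2, (List.append_assoc _ _ _).symm, Yield.nont r hr h1 h3, h4⟩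

lemma Yield.terminals (w : List T) : Yield g (w.map Symbol.terminal) w := by
  induction w with
  | nil => exact Yield.nil
  | cons c w ih => exact Yield.term c ih

lemma Yield.of_derives {s : List (Symbol T g.NT)} {w : List T}
    (h : g.Derives s (w.map Symbol.terminal)) : Yield g s w := by
  induction h using Relation.ReflTransGen.head_induction_on with
  | refl => exact Yield.terminals w
  | head h _ ih =>
    obtain ⟨r, hr, hrw⟩ := h
    obtain ⟨p, q, rfl, rfl⟩ := hrw.exists_parts
    obtain ⟨w1, w3, rfl, h1, h3⟩ := ih.split
    obtain ⟨w1, w2, rfl, h1, h2⟩ := h1.split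
    have := Yield.nont r hr h2 Yield.nil
    rw [List.append_nil] at this
    exact (h1.append this).append h3

lemma Yield.derives {s : List (Symbol T g.NT)} {w : List T} (h : Yield g s w) :
    g.Derives s (w.map Symbol.terminal) := by
  induction h with
  | nil => exact ContextFreeGrammar.Derives.refl _
  | term c h ih => exact ih.append_left [Symbol.terminal c]
  | @nont r hr s w1 w2 h1 h2 ih1 ih2 =>
    rw [List.map_append]
    have h3 : g.Produces (Symbol.nonterminal r.input :: s) (r.output ++ s) :=
      ⟨r, hr, ContextFreeRule.Rewrites.head s⟩
    exact h3.single.trans ((ih1.append_right s).trans (ih2.append_left _))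

/-- A node labelled `B` with a given yield occurs in a context inside `s`, `w`. -/
def Sub (g : ContextFreeGrammar T) (s : List (Symbol T g.NT)) (w : List T)
    (B : g.NT) (w' : List T) : Prop :=
  ∃ u z, w = u ++ w' ++ z ∧ ∀ x, Yield g [Symbol.nonterminal B] x → Yield g s (u ++ x ++ z)

lemma Sub.trans {s : List (Symbol T g.NT)} {w w' w'' : List T} {B C : g.NT}
    (h : Sub g s w B w') (h' : Sub g [Symbol.nonterminal B] w' C w'') : Sub g s w C w'' := by
  obtain ⟨u, z, rfl, h⟩ := h
  obtain ⟨u', z', rfl, h'⟩ := h'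
  refine ⟨u ++ u', z' ++ z, by simp, fun x hx => ?_⟩
  simpa using h _ (h' x hx)

lemma window (b c : ℕ) (hb : ∀ r ∈ g.rules, r.output.length ≤ b) (hc : 1 ≤ c)
    {s : List (Symbol T g.NT)} {w : List T} (h : Yield g s w) (hw : s.length * c < w.length) :
    ∃ B w', Sub g s w B w' ∧ Yield g [Symbol.nonterminal B] w' ∧ (∃ r ∈ g.rules, r.input = B) ∧
      c < w'.length ∧ w'.length ≤ b * c := by
  induction h with
  | nil => simp at hw
  | @term t s w h ih =>
    obtain ⟨B, w', ⟨u, z, rfl, hs⟩, h2⟩ := ih (by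
      simp only [List.length_cons, add_mul] at hw; omega)
    exact ⟨B, w', ⟨t :: u, z, by simp, fun x hx => Yield.term t (hs x hx)⟩, h2⟩
  | @nont r hr s w1 w2 h1 h2 ih1 ih2 =>
    by_cases hw2 : s.length * c < w2.length
    · obtain ⟨B, w', ⟨u, z, rfl, hs⟩, h2'⟩ := ih2 hw2
      refine ⟨B, w', ⟨w1 ++ u, z, by simp, fun x hx => ?_⟩, h2'⟩
      simpa using Yield.nont r hr h1 (hs x hx)
    · have hw1 : c < w1.length := by
        simp only [List.length_cons, List.length_append, add_mul] at hw; omega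
      by_cases hw3 : w1.length ≤ b * c
      · refine ⟨r.input, w1, ⟨[], w2, by simp, fun x hx => ?_⟩, ?_, ⟨r, hr, rfl⟩, hw1, hw3⟩
        · simpa using hx.append h2
        · simpa using Yield.nont r hr h1 Yield.nil
      · have : r.output.length * c ≤ b * c := Nat.mul_le_mul_right _ (hb r hr)
        obtain ⟨B, w', ⟨u, z, rfl, hs⟩, h2'⟩ := ih1 (by omega)
        refine ⟨B, w', ⟨u, z ++ w2, by simp, fun x hx => ?_⟩, h2'⟩
        simpa using Yield.nont r hr (hs x hx) h2

lemma chain (b : ℕ) (hb : ∀ r ∈ g.rules, r.output.length ≤ b) (hb1 : 1 ≤ b) (K : ℕ)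
    {s : List (Symbol T g.NT)} {w : List T} (h : Yield g s w)
    (hw : s.length * b ^ K < w.length) :
    ∃ f : ℕ → g.NT × List T,
      (∀ i ≤ K, Sub g s w (f i).1 (f i).2 ∧ Yield g [Symbol.nonterminal (f i).1] (f i).2 ∧
        (∃ r ∈ g.rules, r.input = (f i).1) ∧ (f i).2.length ≤ b ^ (i + 1)) ∧
      ∀ i j, i < j → j ≤ K → Sub g [Symbol.nonterminal (f j).1] (f j).2 (f i).1 (f i).2 ∧
        (f i).2.length < (f j).2.length := by
  induction K generalizing s w with
  | zero =>
    obtain ⟨B, w', h1, h2, h3, h4, h5⟩ := window b 1 hb le_rfl h (by simpa using hw)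
    refine ⟨fun _ => (B, w'), fun i hi => ⟨h1, h2, h3, ?_⟩, fun i j hij hj => by omega⟩
    obtain rfl : i = 0 := by omega
    simpa using h5
  | succ K ih =>
    obtain ⟨B, w', h1, h2, h3, h4, h5⟩ := window b (b ^ (K + 1)) hb (Nat.one_le_pow _ _ hb1) h hw
    have hmono : ∀ i ≤ K, b ^ (i + 1) ≤ b ^ (K + 1) := fun i hi =>
      Nat.pow_le_pow_right hb1 (by omega)
    obtain ⟨f, hf1, hf2⟩ := ih h2 (by
      have : b ^ K ≤ b ^ (K + 1) := Nat.pow_le_pow_right hb1 (Nat.le_succ K)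
      simp only [List.length_cons, List.length_nil, zero_add, one_mul]; omega)
    refine ⟨fun i => if i = K + 1 then (B, w') else f i, fun i hi => ?_, fun i j hij hj => ?_⟩
    · by_cases hiK : i = K + 1
      · subst hiK
        simp only [if_true]
        exact ⟨h1, h2, h3, by rw [pow_succ']; exact h5⟩
      · simp only [if_neg hiK]
        obtain ⟨k1, k2, k3, k4⟩ := hf1 i (by omega)
        exact ⟨h1.trans k1, k2, k3, k4⟩
    · have hiK : i ≠ K + 1 := by omega
      simp only [if_neg hiK]
      by_cases hjK : j = K + 1
      · simp only [if_pos hjK]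
        obtain ⟨k1, k2, k3, k4⟩ := hf1 i (by omega)
        exact ⟨k1, by have := hmono i (by omega); omega⟩
      · simp only [if_neg hjK]
        exact hf2 i j hij (by omega)

/-- `n`-fold concatenation of a word. -/
def rep (v : List T) : ℕ → List T
  | 0 => []
  | n + 1 => v ++ rep v n

lemma rep_comm (v : List T) (n : ℕ) : rep v n ++ v = v ++ rep v n := by
  induction n with
  | zero => simp [rep]
  | succ n ih => simp only [rep, List.append_assoc, ih]

/-- Pumping lemma, with control by the transition monoid of a finite automaton. -/
theorem pumping {L : Language T} (hL : L.IsContextFree) {σ : Type} [Fintype σ] [DecidableEq σ]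
    (D : DFA T σ) :
    ∃ p : ℕ, ∀ w ∈ L, p < w.length → ∃ u v x y z : List T,
      w = u ++ v ++ x ++ y ++ z ∧ (v ++ x ++ y).length ≤ p ∧ 0 < (v ++ y).length ∧
      ∀ i, (u ++ rep v i ++ x ++ rep y i ++ z) ∈ L ∧
        D.eval (u ++ rep v i ++ x ++ rep y i ++ z) = D.eval w := by
  classical
  obtain ⟨g, rfl⟩ := hL
  set b := g.rules.sup (fun r => r.output.length) + 1 with hbdef
  have hb : ∀ r ∈ g.rules, r.output.length ≤ b := fun r hr =>
    (Finset.le_sup (f := fun r => r.output.length) hr).trans (Nat.le_succ _)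
  set C : Finset (g.NT × (σ → σ)) := (g.rules.image (fun r => r.input)) ×ˢ Finset.univ with hC
  set K := C.card with hK
  refine ⟨b ^ (K + 1), fun w hw hlen => ?_⟩
  have hmem : ∀ w, w ∈ g.language ↔ Yield g [Symbol.nonterminal g.initial] w := fun w =>
    ⟨fun h => Yield.of_derives h, fun h => h.derives⟩
  obtain ⟨f, hf1, hf2⟩ := chain b hb (by omega) K ((hmem w).1 hw) (by
    have : b ^ K ≤ b ^ (K + 1) := Nat.pow_le_pow_right (by omega) (Nat.le_succ K)
    simp only [List.length_cons, List.length_nil, zero_add, one_mul]; omega)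
  have hpig : ∃ i ∈ Finset.range (K + 1), ∃ j ∈ Finset.range (K + 1), i ≠ j ∧
      ((f i).1, fun s => D.evalFrom s (f i).2) = ((f j).1, fun s => D.evalFrom s (f j).2) := by
    apply Finset.exists_ne_map_eq_of_card_lt_of_maps_to (t := C)
    · simp [hK]
    · intro i hi
      obtain ⟨_, _, ⟨r, hr, hr'⟩, _⟩ := hf1 i (by have := Finset.mem_range.1 hi; omega)
      simp only [hC, Finset.coe_product, Set.mem_prod, Finset.coe_image, Finset.coe_univ,
        Set.mem_univ, and_true]
      exact ⟨r, hr, hr'⟩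
  have hpig2 : ∃ i j, i < j ∧ j ≤ K ∧
      ((f i).1, fun s => D.evalFrom s (f i).2) = ((f j).1, fun s => D.evalFrom s (f j).2) := by
    obtain ⟨i, hi, j, hj, hne, he⟩ := hpig
    rw [Finset.mem_range] at hi hj
    rcases lt_or_gt_of_ne hne with h | h
    · exact ⟨i, j, h, by omega, he⟩
    · exact ⟨j, i, h, by omega, he.symm⟩
  obtain ⟨i, j, hij, hj, he⟩ := hpig2
  obtain ⟨⟨v, y, hvy, hin⟩, hl⟩ := hf2 i j hij hj
  obtain ⟨⟨u, z, huz, hout⟩, _, _, hlj⟩ := hf1 j hj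
  obtain ⟨_, hyi, _, _⟩ := hf1 i (by omega)
  rw [Prod.mk.injEq] at he
  obtain ⟨he1, he2⟩ := he
  rw [← he1] at hin hout
  set x := (f i).2
  have hY : ∀ n, Yield g [Symbol.nonterminal (f i).1] (rep v n ++ x ++ rep y n) ∧
      ∀ s, D.evalFrom s (rep v n ++ x ++ rep y n) = D.evalFrom s x := by
    intro n
    induction n with
    | zero => simpa [rep] using hyi
    | succ n ih =>
      have e : rep v (n + 1) ++ x ++ rep y (n + 1) = v ++ (rep v n ++ x ++ rep y n) ++ y := by
        rw [show rep y (n + 1) = rep y n ++ y from (rep_comm y n).symm]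
        simp [rep]
      rw [e]
      refine ⟨hin _ ih.1, fun s => ?_⟩
      have := congrFun he2 s
      simp only [hvy] at this
      rw [DFA.evalFrom_of_append, DFA.evalFrom_of_append, ih.2, this,
        DFA.evalFrom_of_append, DFA.evalFrom_of_append]
  refine ⟨u, v, x, y, z, by rw [huz, hvy]; simp, ?_, ?_, fun n => ⟨?_, ?_⟩⟩
  · rw [← hvy]
    exact hlj.trans (Nat.pow_le_pow_right (by omega) (by omega))
  · rw [hvy] at hl
    simp only [List.length_append] at hl ⊢
    omega
  · rw [hmem]
    simpa using hout _ (hY n).1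
  · have e : u ++ rep v n ++ x ++ rep y n ++ z = u ++ (rep v n ++ x ++ rep y n) ++ z := by simp
    rw [e, huz]
    simp only [DFA.eval]
    rw [DFA.evalFrom_of_append, DFA.evalFrom_of_append, (hY n).2, congrFun he2,
      ← DFA.evalFrom_of_append, ← DFA.evalFrom_of_append, List.append_assoc]

end Pump

section Auto

/-- Letters. -/
abbrev Lt := Fin 2 × Bool

/-- The words `a b^m₁ a b^m₂ a b a⁻¹ b⁻ⁿ a⁻¹ b`. -/
def W (m1 m2 n : ℕ) : List Lt :=
  (0, true) :: (List.replicate m1 (1, true) ++ (0, true) :: (List.replicate m2 (1, true) ++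
    (0, true) :: (1, true) :: (0, false) :: (List.replicate n (1, false) ++
    [(0, false), (1, true)])))

/-- States of the automaton. -/
inductive St
  | s0 | s1 | s2 | s3 | s4 | s5 | s6 | s7 | s8 | s9 | s10 | dead
deriving DecidableEq

instance : Fintype St where
  elems := {.s0, .s1, .s2, .s3, .s4, .s5, .s6, .s7, .s8, .s9, .s10, .dead}
  complete := by intro x; cases x <;> decide

/-- Transition function. -/
def stp : St → Lt → St
  | .s0, (0, true) => .s1
  | .s1, (1, true) => .s2
  | .s2, (1, true) => .s1
  | .s1, (0, true) => .s3
  | .s3, (1, true) => .s4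
  | .s4, (1, true) => .s3
  | .s3, (0, true) => .s5
  | .s5, (1, true) => .s6
  | .s6, (0, false) => .s7
  | .s7, (1, false) => .s8
  | .s8, (1, false) => .s7
  | .s7, (0, false) => .s9
  | .s9, (1, true) => .s10
  | _, _ => .dead

/-- The automaton for the regular set of words `W` with even parameters. -/
def Dn : DFA Lt St := ⟨stp, .s0, {.s10}⟩

lemma evalFrom_even (s t : St) (c : Lt) (h1 : stp s c = t) (h2 : stp t c = s) (k : ℕ)
    (hk : Even k) : Dn.evalFrom s (List.replicate k c) = s := by
  obtain ⟨k, rfl⟩ := hk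
  induction k with
  | zero => rfl
  | succ k ih =>
    rw [show k + 1 + (k + 1) = (k + k) + 1 + 1 by ring, List.replicate_succ, List.replicate_succ]
    simp only [DFA.evalFrom_cons]
    change Dn.evalFrom (stp (stp s c) c) _ = _
    rw [h1, h2, ih]

lemma eval_W {m1 m2 n : ℕ} (h1 : Even m1) (h2 : Even m2) (h3 : Even n) :
    Dn.eval (W m1 m2 n) = .s10 := by
  have e : Dn.step = stp := rfl
  have e0 : Dn.start = .s0 := rfl
  have e1 : stp .s0 (0, true) = .s1 := rfl
  have e2 : stp .s1 (0, true) = .s3 := rfl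
  have e3 : stp (stp (stp .s3 (0, true)) (1, true)) (0, false) = .s7 := rfl
  simp only [DFA.eval, W, DFA.evalFrom_cons, DFA.evalFrom_of_append, e, e0, e1,
    evalFrom_even .s1 .s2 (1, true) rfl rfl _ h1, e2, evalFrom_even .s3 .s4 (1, true) rfl rfl _ h2, e3,
    evalFrom_even .s7 .s8 (1, false) rfl rfl _ h3]
  rfl

/-- Description of the words leading to each state. -/
def dsc (w : List Lt) : St → Prop
  | .s0 => w = []
  | .s1 => ∃ i, Even i ∧ w = (0, true) :: List.replicate i (1, true)
  | .s2 => ∃ i, Odd i ∧ w = (0, true) :: List.replicate i (1, true)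
  | .s3 => ∃ i j, Even i ∧ Even j ∧ w = (0, true) :: (List.replicate i (1, true) ++
      (0, true) :: List.replicate j (1, true))
  | .s4 => ∃ i j, Even i ∧ Odd j ∧ w = (0, true) :: (List.replicate i (1, true) ++
      (0, true) :: List.replicate j (1, true))
  | .s5 => ∃ i j, Even i ∧ Even j ∧ w = (0, true) :: (List.replicate i (1, true) ++
      (0, true) :: (List.replicate j (1, true) ++ [(0, true)]))
  | .s6 => ∃ i j, Even i ∧ Even j ∧ w = (0, true) :: (List.replicate i (1, true) ++
      (0, true) :: (List.replicate j (1, true) ++ [(0, true), (1, true)]))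
  | .s7 => ∃ i j k, Even i ∧ Even j ∧ Even k ∧ w = (0, true) :: (List.replicate i (1, true) ++
      (0, true) :: (List.replicate j (1, true) ++ (0, true) :: (1, true) :: (0, false) ::
        List.replicate k (1, false)))
  | .s8 => ∃ i j k, Even i ∧ Even j ∧ Odd k ∧ w = (0, true) :: (List.replicate i (1, true) ++
      (0, true) :: (List.replicate j (1, true) ++ (0, true) :: (1, true) :: (0, false) ::
        List.replicate k (1, false)))
  | .s9 => ∃ i j k, Even i ∧ Even j ∧ Even k ∧ w = (0, true) :: (List.replicate i (1, true) ++
      (0, true) :: (List.replicate j (1, true) ++ (0, true) :: (1, true) :: (0, false) ::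
        (List.replicate k (1, false) ++ [(0, false)])))
  | .s10 => ∃ i j k, Even i ∧ Even j ∧ Even k ∧ w = W i j k
  | .dead => True

lemma dsc_step (w : List Lt) (s : St) (c : Lt) (h : dsc w s) : dsc (w ++ [c]) (stp s c) := by
  obtain ⟨l, t⟩ := c
  cases s <;> fin_cases l <;> cases t <;> simp only [dsc, stp] at h ⊢
  · subst h; exact ⟨0, by simp, by simp⟩
  · obtain ⟨i, hi, rfl⟩ := h
    exact ⟨i, 0, hi, by simp, by simp⟩
  · obtain ⟨i, hi, rfl⟩ := h
    exact ⟨i + 1, hi.add_one, by simp [List.replicate_succ']⟩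
  · obtain ⟨i, hi, rfl⟩ := h
    exact ⟨i + 1, hi.add_one, by simp [List.replicate_succ']⟩
  · obtain ⟨i, j, hi, hj, rfl⟩ := h
    exact ⟨i, j, hi, hj, by simp⟩
  · obtain ⟨i, j, hi, hj, rfl⟩ := h
    exact ⟨i, j + 1, hi, hj.add_one, by simp [List.replicate_succ']⟩
  · obtain ⟨i, j, hi, hj, rfl⟩ := h
    exact ⟨i, j + 1, hi, hj.add_one, by simp [List.replicate_succ']⟩
  · obtain ⟨i, j, hi, hj, rfl⟩ := h
    exact ⟨i, j, hi, hj, by simp⟩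
  · obtain ⟨i, j, hi, hj, rfl⟩ := h
    exact ⟨i, j, 0, hi, hj, by simp, by simp⟩
  · obtain ⟨i, j, k, hi, hj, hk, rfl⟩ := h
    exact ⟨i, j, k, hi, hj, hk, by simp⟩
  · obtain ⟨i, j, k, hi, hj, hk, rfl⟩ := h
    exact ⟨i, j, k + 1, hi, hj, hk.add_one, by simp [List.replicate_succ']⟩
  · obtain ⟨i, j, k, hi, hj, hk, rfl⟩ := h
    exact ⟨i, j, k + 1, hi, hj, hk.add_one, by simp [List.replicate_succ']⟩
  · obtain ⟨i, j, k, hi, hj, hk, rfl⟩ := h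
    exact ⟨i, j, k, hi, hj, hk, by simp [W]⟩

lemma dsc_eval (w : List Lt) : dsc w (Dn.eval w) := by
  induction w using List.reverseRecOn with
  | nil => rfl
  | append_singleton w c ih =>
    rw [DFA.eval_append_singleton]
    exact dsc_step w _ c ih

lemma W_of_eval {w : List Lt} (h : Dn.eval w = .s10) :
    ∃ i j k, Even i ∧ Even j ∧ Even k ∧ w = W i j k := by
  have := dsc_eval w
  rwa [h] at this

end Auto

section Suff

/-- Generator `a`. -/
abbrev ga : F2 := FreeGroup.of 0
/-- Generator `b`. -/
abbrev gb : F2 := FreeGroup.of 1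

lemma mk_cons_true (i : Fin 2) (L : List Lt) :
    (FreeGroup.mk ((i, true) :: L) : F2) = FreeGroup.of i * FreeGroup.mk L := by
  rw [FreeGroup.of, FreeGroup.mul_mk]; rfl

lemma mk_cons_false (i : Fin 2) (L : List Lt) :
    (FreeGroup.mk ((i, false) :: L) : F2) = (FreeGroup.of i)⁻¹ * FreeGroup.mk L := by
  rw [FreeGroup.of, FreeGroup.inv_mk, FreeGroup.mul_mk]; rfl

lemma mk_rep_true (i : Fin 2) (m : ℕ) :
    (FreeGroup.mk (List.replicate m (i, true)) : F2) = FreeGroup.of i ^ m := by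
  induction m with
  | zero => rfl
  | succ m ih => rw [List.replicate_succ, mk_cons_true, ih, pow_succ']

lemma mk_rep_false (i : Fin 2) (m : ℕ) :
    (FreeGroup.mk (List.replicate m (i, false)) : F2) = ((FreeGroup.of i)⁻¹) ^ m := by
  induction m with
  | zero => rfl
  | succ m ih => rw [List.replicate_succ, mk_cons_false, ih, pow_succ']

lemma mk_W (m1 m2 n : ℕ) : (FreeGroup.mk (W m1 m2 n) : F2) =
    ga * (gb ^ m1 * (ga * (gb ^ m2 * (ga * (gb * (ga⁻¹ * (gb⁻¹ ^ n * (ga⁻¹ * gb)))))))) := by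
  simp only [W, mk_cons_true, mk_cons_false, ← FreeGroup.mul_mk, mk_rep_true, mk_rep_false,
    ← FreeGroup.one_eq_mk, mul_one]

lemma W_reduced (m1 m2 n : ℕ) : FreeGroup.IsReduced (W m1 m2 n) := by
  have hr : ∀ (k : ℕ) (c : Lt), List.IsChain (fun a b : Lt => a.1 = b.1 → a.2 = b.2)
      (List.replicate k c) := fun k c => List.isChain_replicate_of_rel k (fun _ => rfl)
  simp only [W, FreeGroup.IsReduced]
  cases m1 <;> cases m2 <;> cases n <;>
  simp [List.isChain_append, List.isChain_cons, hr, List.replicate_succ,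
    List.getLast?_replicate, List.head?_replicate] <;> grind

lemma toWord_W (m1 m2 n : ℕ) : (FreeGroup.mk (W m1 m2 n) : F2).toWord = W m1 m2 n := by
  rw [FreeGroup.toWord_mk, (W_reduced m1 m2 n).reduce_eq]

lemma W_mem (m : ℕ) : W m m m ∈ ppLanguage := by
  refine ⟨FreeGroup.mk (W m m m), ?_, ?_, (toWord_W m m m).symm⟩
  · intro x hx y hy
    rw [toWord_W] at hx hy
    have h1 : (W m m m).head? = some (0, true) := rfl
    have h2 : (W m m m).getLast? = some (1, true) := by simp [W, List.getLast?_cons]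
    rw [h1] at hx
    rw [h2] at hy
    simp only [Option.mem_def, Option.some.injEq] at hx hy
    subst hx hy
    decide
  · let f : F2 →* F2 := FreeGroup.lift ![ga * ((ga ^ 2 * gb) ^ m)⁻¹, ga ^ 2 * gb]
    let h : F2 →* F2 := FreeGroup.lift ![ga * gb ^ m, ((ga * gb ^ m) ^ 2)⁻¹ * gb]
    have f0 : f ga = ga * ((ga ^ 2 * gb) ^ m)⁻¹ := by simp [f]
    have f1 : f gb = ga ^ 2 * gb := by simp [f]
    have h0 : h ga = ga * gb ^ m := by simp [h]
    have h1 : h gb = ((ga * gb ^ m) ^ 2)⁻¹ * gb := by simp [h]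
    have hf : h.comp f = MonoidHom.id F2 := by
      ext i
      fin_cases i
      · change h (f ga) = ga
        rw [f0]
        simp only [map_mul, map_inv, map_pow, h0, h1]
        group
      · change h (f gb) = gb
        rw [f1]
        simp only [map_mul, map_pow, h0, h1]
        group
    have fh : f.comp h = MonoidHom.id F2 := by
      ext i
      fin_cases i
      · change f (h ga) = ga
        rw [h0]
        simp only [map_mul, map_pow, f0, f1]
        group
      · change f (h gb) = gb
        rw [h1]
        simp only [map_mul, map_inv, map_pow, f0, f1]
        group
    refine ⟨MonoidHom.toMulEquiv f h hf fh, ?_⟩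
    have key : f (FreeGroup.mk (W m m m)) = ga ^ 5 * gb * gb := by
      rw [mk_W]
      simp only [map_mul, map_inv, map_pow, f0, f1, inv_pow]
      group
    change Positive2 (f (FreeGroup.mk (W m m m)))
    rw [key]
    have ha : ga ∈ Submonoid.closure (Set.range (FreeGroup.of : Fin 2 → F2)) :=
      Submonoid.subset_closure ⟨0, rfl⟩
    have hb : gb ∈ Submonoid.closure (Set.range (FreeGroup.of : Fin 2 → F2)) :=
      Submonoid.subset_closure ⟨1, rfl⟩
    exact Submonoid.mul_mem _ (Submonoid.mul_mem _ (Submonoid.pow_mem _ ha 5) hb) hb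

end Suff

section Key

/-- Integral Laurent polynomials. -/
abbrev Lam := LaurentPolynomial ℤ

open LaurentPolynomial

lemma units_lam {U V : Lam} (h : U * V = 1) : ∃ k : ℤ, U = T k ∨ U = -T k := by
  obtain ⟨n, f, hf⟩ := exists_T_pow U
  obtain ⟨m, g, hg⟩ := exists_T_pow V
  have hfg : f * g = Polynomial.X ^ (n + m) := by
    apply Polynomial.toLaurent_injective
    rw [map_mul, hf, hg, Polynomial.toLaurent_X_pow]
    push_cast
    rw [T_add]
    linear_combination (T (n : ℤ) * T (m : ℤ)) * h
  have hd : f ∣ Polynomial.X ^ (n + m) := ⟨g, hfg.symm⟩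
  obtain ⟨i, _, u, hi⟩ := (dvd_prime_pow Polynomial.prime_X _).1 hd
  have hu : IsUnit (u : Polynomial ℤ) := u.isUnit
  obtain ⟨c, hc, hcu⟩ := Polynomial.isUnit_iff.1 hu
  have hU : U = U * T n * T (-n) := by
    rw [mul_T_assoc, add_neg_cancel, T_zero, mul_one]
  have hff : ∀ q : Lam, q * q = 1 → Polynomial.toLaurent f * q = T i → U = q * T (i - n) := by
    intro q hq h1
    rw [hU, ← hf, T_sub, ← h1]
    linear_combination (-(Polynomial.toLaurent f * T (-(n : ℤ)))) * hq
  have hiT := congrArg Polynomial.toLaurent hi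
  rw [map_mul, Polynomial.toLaurent_X_pow, ← hcu] at hiT
  rcases Int.isUnit_iff.1 hc with rfl | rfl
  · refine ⟨i - n, Or.inl ?_⟩
    rw [hff 1 (by ring) (by simpa using hiT)]
    ring
  · refine ⟨i - n, Or.inr ?_⟩
    rw [hff (-1) (by ring) (by simpa using hiT)]
    ring

/-- The affine group over the Laurent polynomials. -/
@[ext] structure Aff where
  /-- exponent -/
  e : ℤ
  /-- translation part -/
  d : Lam

noncomputable instance : Mul Aff := ⟨fun x y => ⟨x.e + y.e, x.d + T x.e * y.d⟩⟩
noncomputable instance : One Aff := ⟨⟨0, 0⟩⟩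
noncomputable instance : Inv Aff := ⟨fun x => ⟨-x.e, -(T (-x.e) * x.d)⟩⟩

lemma aff_mul_e (x y : Aff) : (x * y).e = x.e + y.e := rfl
lemma aff_mul_d (x y : Aff) : (x * y).d = x.d + T x.e * y.d := rfl
lemma aff_one_e : (1 : Aff).e = 0 := rfl
lemma aff_one_d : (1 : Aff).d = 0 := rfl
lemma aff_inv_e (x : Aff) : (x⁻¹).e = -x.e := rfl
lemma aff_inv_d (x : Aff) : (x⁻¹).d = -(T (-x.e) * x.d) := rfl

noncomputable instance : Group Aff := Group.ofLeftAxioms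
  (by
    intro x y z
    ext1
    · simp only [aff_mul_e]; ring
    · simp only [aff_mul_e, aff_mul_d, T_add]; ring)
  (by
    intro x
    ext1
    · simp only [aff_mul_e, aff_one_e]; ring
    · simp only [aff_one_e, aff_one_d, aff_mul_d, T_zero]; ring)
  (by
    intro x
    ext1
    · simp only [aff_mul_e, aff_one_e, aff_inv_e]; ring
    · simp only [aff_inv_e, aff_inv_d, aff_one_d, aff_mul_d]; ring)

/-- Laurent polynomials that are sums of monomials. -/
noncomputable def NS : AddSubmonoid Lam := AddSubmonoid.closure (Set.range (fun k : ℤ => (T k : Lam)))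

lemma T_mem_NS (k : ℤ) : (T k : Lam) ∈ NS := AddSubmonoid.subset_closure ⟨k, rfl⟩

lemma T_mul_mem_NS (k : ℤ) {f : Lam} (hf : f ∈ NS) : T k * f ∈ NS := by
  induction hf using AddSubmonoid.closure_induction with
  | mem x hx =>
    obtain ⟨j, rfl⟩ := hx
    simp only [← T_add]
    exact T_mem_NS _
  | zero => rw [mul_zero]; exact NS.zero_mem
  | add x y _ _ hx hy => rw [mul_add]; exact NS.add_mem hx hy

lemma coeff_NS {f : Lam} (hf : f ∈ NS) (k : ℤ) : 0 ≤ f.coeff k := by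
  induction hf using AddSubmonoid.closure_induction with
  | mem x hx =>
    obtain ⟨j, rfl⟩ := hx
    simp only [T_apply]
    split_ifs <;> simp
  | zero => simp
  | add x y _ _ hx hy => rw [AddMonoidAlgebra.coeff_add, Finsupp.add_apply]; exact add_nonneg hx hy

/-- Evaluation at one. -/
noncomputable def ev : Lam →+* ℤ := LaurentPolynomial.eval₂ (RingHom.id ℤ) (1 : ℤˣ)

lemma ev_T (k : ℤ) : ev (T k) = 1 := by
  simp [ev, LaurentPolynomial.eval₂_T]

lemma ev_NS {f : Lam} (hf : f ∈ NS) : 0 ≤ ev f := by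
  induction hf using AddSubmonoid.closure_induction with
  | mem x hx =>
    obtain ⟨j, rfl⟩ := hx
    simp [ev_T]
  | zero => simp
  | add x y _ _ hx hy => rw [map_add]; exact add_nonneg hx hy

lemma span_pos (θ : F2 →* Aff) {p : F2} (hp : Positive2 p) : ∃ P ∈ NS, ∃ Q ∈ NS,
    T (θ p).e - 1 = P * (T (θ ga).e - 1) + Q * (T (θ gb).e - 1) ∧
    (θ p).d = P * (θ ga).d + Q * (θ gb).d := by
  induction hp using Submonoid.closure_induction with
  | mem x hx =>
    obtain ⟨i, rfl⟩ := hx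
    have h1 : (1 : Lam) ∈ NS := by rw [← T_zero]; exact T_mem_NS 0
    fin_cases i
    · exact ⟨1, h1, 0, NS.zero_mem, by simp, by simp⟩
    · exact ⟨0, NS.zero_mem, 1, h1, by simp, by simp⟩
  | one =>
    refine ⟨0, NS.zero_mem, 0, NS.zero_mem, ?_, ?_⟩
    · rw [map_one, aff_one_e, T_zero]; ring
    · rw [map_one, aff_one_d]; ring
  | mul x y _ _ hx hy =>
    obtain ⟨P, hP, Q, hQ, h1, h2⟩ := hx
    obtain ⟨P', hP', Q', hQ', hy1, hy2⟩ := hy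
    refine ⟨P + T (θ x).e * P', NS.add_mem hP (T_mul_mem_NS _ hP'),
      Q + T (θ x).e * Q', NS.add_mem hQ (T_mul_mem_NS _ hQ'), ?_, ?_⟩
    · rw [map_mul, aff_mul_e, T_add]
      linear_combination h1 + T (θ x).e * hy1
    · rw [map_mul, aff_mul_d]
      linear_combination T (θ x).e * hy2 + h2

lemma span_all (θ : F2 →* Aff) (p : F2) : ∃ P Q : Lam,
    T (θ p).e - 1 = P * (T (θ ga).e - 1) + Q * (T (θ gb).e - 1) ∧
    (θ p).d = P * (θ ga).d + Q * (θ gb).d := by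
  induction p using FreeGroup.induction_on with
  | C1 =>
    refine ⟨0, 0, ?_, ?_⟩
    · rw [map_one, aff_one_e, T_zero]; ring
    · rw [map_one, aff_one_d]; ring
  | of i =>
    fin_cases i
    · exact ⟨1, 0, by simp, by simp⟩
    · exact ⟨0, 1, by simp, by simp⟩
  | inv_of i h =>
    obtain ⟨P, Q, h1, h2⟩ := h
    refine ⟨-(T (-(θ (FreeGroup.of i)).e) * P), -(T (-(θ (FreeGroup.of i)).e) * Q), ?_, ?_⟩
    · rw [map_inv, aff_inv_e]
      have : (T (-(θ (FreeGroup.of i)).e) : Lam) * T ((θ (FreeGroup.of i)).e) = 1 := by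
        rw [← T_add, neg_add_cancel, T_zero]
      linear_combination this - T (-(θ (FreeGroup.of i)).e) * h1
    · rw [map_inv, aff_inv_d]
      linear_combination -T (-(θ (FreeGroup.of i)).e) * h2
  | mul x y hx hy =>
    obtain ⟨P, Q, h1, h2⟩ := hx
    obtain ⟨P', Q', hy1, hy2⟩ := hy
    refine ⟨P + T (θ x).e * P', Q + T (θ x).e * Q', ?_, ?_⟩
    · rw [map_mul, aff_mul_e, T_add]
      linear_combination h1 + T (θ x).e * hy1
    · rw [map_mul, aff_mul_d]
      linear_combination T (θ x).e * hy2 + h2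

/-- The geometric sum `1 + T + ... + T^(l-1)`. -/
noncomputable def geo (l : ℕ) : Lam := ∑ i ∈ Finset.range l, T (i : ℤ)

lemma geo_mul (l : ℕ) : (T 1 - 1 : Lam) * geo l = T (l : ℤ) - 1 := by
  induction l with
  | zero => simp [geo]
  | succ l ih =>
    have : geo (l + 1) = geo l + T (l : ℤ) := Finset.sum_range_succ _ _
    rw [this, mul_add, ih]
    push_cast
    rw [T_add]
    ring

lemma ev_geo (l : ℕ) : ev (geo l) = l := by
  simp [geo, ev_T]

lemma coeff_geo (l : ℕ) (e k : ℤ) :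
    (T e * geo l : Lam).coeff k = if k - l < e ∧ e ≤ k then 1 else 0 := by
  induction l with
  | zero =>
    rw [if_neg (by push_cast; omega)]
    simp [geo]
  | succ l ih =>
    have : geo (l + 1) = geo l + T (l : ℤ) := Finset.sum_range_succ _ _
    rw [this, mul_add, AddMonoidAlgebra.coeff_add, Finsupp.add_apply, ih, ← T_add, T_apply]
    push_cast
    split_ifs <;> omega

lemma T_one_ne : (T 1 - 1 : Lam) ≠ 0 := by
  intro h
  have := congrArg (fun f : Lam => f.coeff 1) h
  rw [← T_zero] at this
  simp only [AddMonoidAlgebra.coeff_sub, Finsupp.sub_apply, T_apply] at this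
  simp at this

/-- The representation. -/
noncomputable def rho (c : ℤ) : F2 →* Aff := FreeGroup.lift ![⟨-c, 1⟩, ⟨1, 0⟩]

lemma rho_a (c : ℤ) : rho c ga = ⟨-c, 1⟩ := by simp [rho]
lemma rho_b (c : ℤ) : rho c gb = ⟨1, 0⟩ := by simp [rho]

lemma geo_pos (c : ℤ) {w : F2} (hw : PotPos2 w) (he : (rho c w).e = 0)
    (hev : ev (rho c w).d = 1) : ∃ l : ℕ, 0 < l ∧ (rho c w).d * geo l ∈ NS := by
  obtain ⟨φ, hφ⟩ := hw
  set θ : F2 →* Aff := (rho c).comp φ.symm.toMonoidHom with hθ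
  have hθφ : ∀ g, θ (φ g) = rho c g := fun g => by simp [hθ]
  obtain ⟨N1, hN1, N2, hN2, k1, k2⟩ := span_pos θ hφ
  obtain ⟨P1, Q1, a1, a2⟩ := span_all θ (φ ga)
  obtain ⟨P2, Q2, b1, b2⟩ := span_all θ (φ gb)
  obtain ⟨P3, Q3, c1, c2⟩ := span_all (rho c) (φ.symm ga)
  obtain ⟨P4, Q4, d1, d2⟩ := span_all (rho c) (φ.symm gb)
  have hsa : rho c (φ.symm ga) = θ ga := rfl
  have hsb : rho c (φ.symm gb) = θ gb := rfl
  rw [hθφ] at k1 k2 a1 a2 b1 b2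
  rw [he, T_zero] at k1
  rw [hsa, rho_a, rho_b] at c1 c2
  rw [hsb, rho_a, rho_b] at d1 d2
  rw [rho_a] at a1 a2
  rw [rho_b] at b1 b2
  simp only at a1 a2 b1 b2 c1 c2 d1 d2
  set D := (rho c w).d
  set r := (θ ga).e
  set s := (θ gb).e
  set f := (θ ga).d
  set g := (θ gb).d
  set U := P3 * Q4 - P4 * Q3 with hU
  set V := P1 * Q2 - P2 * Q1 with hV
  have hJ : (T r - 1) * g - (T s - 1) * f = -U * (T 1 - 1) := by
    rw [c1, c2, d1, d2]; ring
  have hJ2 : V * ((T r - 1) * g - (T s - 1) * f) = -(T 1 - 1) := by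
    have : V * ((T r - 1) * g - (T s - 1) * f) =
        (P1 * (T r - 1) + Q1 * (T s - 1)) * (P2 * f + Q2 * g) -
        (P2 * (T r - 1) + Q2 * (T s - 1)) * (P1 * f + Q1 * g) := by rw [hV]; ring
    rw [this, ← a1, ← a2, ← b1, ← b2]; ring
  have hUV : U * V = 1 := by
    apply mul_right_cancel₀ T_one_ne
    rw [hJ] at hJ2
    linear_combination -hJ2
  have e1 : D * (T r - 1) = N2 * (-U * (T 1 - 1)) := by
    rw [← hJ]
    linear_combination (T r - 1) * k2 - f * k1
  have e2 : D * (T s - 1) = N1 * (U * (T 1 - 1)) := by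
    have : U * (T 1 - 1) = -((T r - 1) * g - (T s - 1) * f) := by rw [hJ]; ring
    rw [this]
    linear_combination (T s - 1) * k2 - g * k1
  have hrs : r ≠ 0 ∨ s ≠ 0 := by
    by_contra h
    push Not at h
    rw [h.1, h.2, T_zero] at hJ2
    apply T_one_ne
    linear_combination hJ2
  have main : ∃ q : ℤ, q ≠ 0 ∧ ∃ N ∈ NS, ∃ A B : Lam, A * B = 1 ∧
      D * (T q - 1) = N * A * (T 1 - 1) := by
    rcases hrs with h | h
    · exact ⟨r, h, N2, hN2, -U, -V, by linear_combination hUV, by rw [e1]; ring⟩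
    · exact ⟨s, h, N1, hN1, U, V, hUV, by rw [e2]; ring⟩
  have main2 : ∃ l : ℕ, 0 < l ∧ ∃ N ∈ NS, ∃ A B : Lam, A * B = 1 ∧
      D * geo l = N * A := by
    obtain ⟨q, hq, N, hN, A, B, hAB, h⟩ := main
    rcases lt_or_gt_of_ne hq with hq | hq
    · obtain ⟨l, hl⟩ := Int.eq_ofNat_of_zero_le (show 0 ≤ -q by omega)
      have hT : (T (-q) : Lam) * T q = 1 := by rw [← T_add, neg_add_cancel, T_zero]
      refine ⟨l, by omega, N, hN, -(T (-q) * A), -(T q * B),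
        by linear_combination (A * B) * hT + hAB, ?_⟩
      apply mul_right_cancel₀ T_one_ne
      have := geo_mul l
      rw [← hl] at this
      linear_combination D * this - T (-q) * h + D * hT
    · obtain ⟨l, hl⟩ := Int.eq_ofNat_of_zero_le (show 0 ≤ q by omega)
      refine ⟨l, by omega, N, hN, A, B, hAB, ?_⟩
      apply mul_right_cancel₀ T_one_ne
      have := geo_mul l
      rw [← hl] at this
      linear_combination D * this + h
  obtain ⟨l, hl, N, hN, A, B, hAB, h⟩ := main2
  refine ⟨l, hl, ?_⟩
  obtain ⟨k, rfl | rfl⟩ := units_lam hAB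
  · rw [h, mul_comm]
    exact T_mul_mem_NS k hN
  · exfalso
    have h' := congrArg ev h
    rw [map_mul, map_mul, map_neg, ev_T, hev, ev_geo] at h'
    have := ev_NS hN
    omega

lemma rho_pow_b (c : ℤ) (m : ℕ) : (rho c) gb ^ m = ⟨m, 0⟩ := by
  induction m with
  | zero => rfl
  | succ m ih =>
    rw [pow_succ, ih, rho_b]
    ext1
    · simp [aff_mul_e]
    · simp [aff_mul_d]

lemma rho_W (m1 m2 n : ℕ) (c : ℤ) (hc : c = m1 + m2 + 2 - n) :
    (rho c (FreeGroup.mk (W m1 m2 n))).e = 0 ∧ (rho c (FreeGroup.mk (W m1 m2 n))).d =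
      T 0 + T (m1 - c) + T (n - 2 - c) - T (n - 1 - c) - T (-1) := by
  rw [mk_W]
  simp only [map_mul, map_pow, map_inv, inv_pow, rho_pow_b, rho_a]
  rw [rho_b]
  constructor
  · simp only [aff_mul_e, aff_inv_e]
    omega
  · simp only [aff_mul_d, aff_mul_e, aff_inv_e, aff_inv_d]
    simp only [mul_zero, neg_zero, add_zero, zero_add, mul_add, mul_neg, mul_one, ← T_add,
      neg_neg]
    rw [T_zero, sub_eq_add_neg, sub_eq_add_neg]
    simp only [add_assoc]
    congr 2
    · ring_nf
    · have hT : ∀ x y : ℤ, x = y → (T x : Lam) = T y := fun x y h => by rw [h]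
      refine congrArg₂ _ (hT _ _ (by omega)) (congrArg₂ _ (congrArg _ (hT _ _ (by omega)))
        (congrArg _ (hT _ _ (by omega))))

lemma coeff_W {m1 m2 n : ℕ} (h : W m1 m2 n ∈ ppLanguage) : ∃ l : ℕ, 0 < l ∧ ∀ k e1 e2 e3 : ℤ,
    e1 = n - 2 - m2 → e2 = 2 * n - m1 - m2 - 4 → e3 = 2 * n - m1 - m2 - 3 →
    0 ≤ (if k - l < 0 ∧ 0 ≤ k then (1 : ℤ) else 0) + (if k - l < e1 ∧ e1 ≤ k then 1 else 0) +
      (if k - l < e2 ∧ e2 ≤ k then 1 else 0) - (if k - l < e3 ∧ e3 ≤ k then 1 else 0) -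
      (if k - l < -1 ∧ -1 ≤ k then 1 else 0) := by
  obtain ⟨w, -, hw, e⟩ := h
  have hwm : w = FreeGroup.mk (W m1 m2 n) := by rw [e, FreeGroup.mk_toWord]
  subst hwm
  obtain ⟨he, hd⟩ := rho_W m1 m2 n _ rfl
  obtain ⟨l, hl, hN⟩ := geo_pos _ hw he (by rw [hd]; simp [ev_T])
  refine ⟨l, hl, fun k e1 e2 e3 h1 h2 h3 => ?_⟩
  have hk := coeff_NS hN k
  rw [hd, show (m1 : ℤ) - (m1 + m2 + 2 - n) = e1 by omega,
    show (n : ℤ) - 2 - (m1 + m2 + 2 - n) = e2 by omega,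
    show (n : ℤ) - 1 - (m1 + m2 + 2 - n) = e3 by omega] at hk
  simp only [add_mul, sub_mul, AddMonoidAlgebra.coeff_add, AddMonoidAlgebra.coeff_sub,
    Finsupp.add_apply, Finsupp.sub_apply, coeff_geo] at hk
  exact hk

lemma key1 {m1 m2 n : ℕ} (h : W m1 m2 n ∈ ppLanguage) (h1 : m1 + 2 ≤ n)
    (h2 : m1 + m2 + 3 ≠ 2 * n) : False := by
  obtain ⟨l, hl, hk⟩ := coeff_W h
  have := hk (2 * n - m1 - m2 - 3 + l - 1) _ _ _ rfl rfl rfl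
  split_ifs at this <;> omega

lemma key2 {m1 m2 n : ℕ} (h : W m1 m2 n ∈ ppLanguage) (h1 : m2 + 2 ≤ n)
    (h2 : m1 + m2 + 3 ≠ 2 * n) : False := by
  obtain ⟨l, hl, hk⟩ := coeff_W h
  have := hk (-1) _ _ _ rfl rfl rfl
  split_ifs at this <;> omega

end Key

section Final

lemma count_rep (c : Lt) (v : List Lt) (n : ℕ) : (rep v n).count c = n * v.count c := by
  induction n with
  | zero => simp [rep]
  | succ n ih => rw [rep, List.count_append, ih]; ring

lemma length_rep (v : List Lt) (n : ℕ) : (rep v n).length = n * v.length := by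
  induction n with
  | zero => simp [rep]
  | succ n ih => rw [rep, List.length_append, ih]; ring

lemma count_W (i j k : ℕ) : (W i j k).count (1, false) = k := by
  simp [W, List.count_replicate]

lemma length_W (i j k : ℕ) : (W i j k).length = i + j + k + 7 := by
  simp [W]; ring

lemma prefix_inj (m n : ℕ) (X Y : List Lt)
    (h : List.replicate m ((1, true) : Lt) ++ (0, true) :: X =
      List.replicate n (1, true) ++ (0, true) :: Y) : m = n := by
  induction m generalizing n with
  | zero =>
    cases n with
    | zero => rfl
    | succ n => simp [List.replicate_succ] at h
  | succ m ih =>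
    cases n with
    | zero => simp [List.replicate_succ] at h
    | succ n =>
      simp only [List.replicate_succ, List.cons_append, List.cons.injEq, true_and] at h
      rw [ih n h]

theorem final (hL : ppLanguage.IsContextFree) : False := by
  obtain ⟨p, hp⟩ := pumping hL Dn
  set m := 2 * (p + 1) with hm
  have hme : Even m := ⟨p + 1, by omega⟩
  obtain ⟨u, v, x, y, z, hw, hl, hpos, hi⟩ := hp _ (W_mem m) (by rw [length_W]; omega)
  have hev := eval_W hme hme hme
  have hWi : ∀ i, ∃ m1 m2 n, Even m1 ∧ Even m2 ∧ Even n ∧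
      u ++ rep v i ++ x ++ rep y i ++ z = W m1 m2 n ∧ W m1 m2 n ∈ ppLanguage := by
    intro i
    obtain ⟨h1, h2⟩ := hi i
    obtain ⟨m1, m2, n, e1, e2, e3, e⟩ := W_of_eval (h2.trans hev)
    exact ⟨m1, m2, n, e1, e2, e3, e, e ▸ h1⟩
  have hcw := congrArg (List.count (1, false)) hw
  have hlw := congrArg List.length hw
  simp only [count_W, length_W, List.count_append, List.length_append] at hcw hlw hpos hl
  rcases Nat.eq_zero_or_pos (v.count (1, false) + y.count (1, false)) with ht | ht
  · obtain ⟨m1, m2, n, ⟨e1, rfl⟩, ⟨e2, rfl⟩, ⟨e3, rfl⟩, e, hmem⟩ := hWi 0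
    have hc := congrArg (List.count (1, false)) e
    have hl' := congrArg List.length e
    simp only [count_W, length_W, List.count_append, List.length_append, rep, List.count_nil,
      List.length_nil] at hc hl'
    by_cases h : e1 + e1 + 2 ≤ e3 + e3
    · exact key1 hmem h (by omega)
    · exact key2 hmem (by omega) (by omega)
  · have hu : m + 2 ≤ u.length := by
      by_contra hu
      have e : W m m m = ((0, true) :: (List.replicate m (1, true) ++
          (0, true) :: List.replicate m (1, true))) ++ ((0, true) :: (1, true) :: (0, false) ::
          (List.replicate m (1, false) ++ [(0, false), (1, true)])) := by simp [W]
      have h1 : u ++ v ++ x ++ y <+: W m m m := ⟨z, hw.symm⟩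
      have h2 : ((0, true) :: (List.replicate m (1, true) ++
          (0, true) :: List.replicate m (1, true))) <+: W m m m := ⟨_, e.symm⟩
      obtain ⟨r, hr⟩ := List.prefix_of_prefix_length_le h1 h2 (by simp; omega)
      have := congrArg (List.count (1, false)) hr
      simp [List.count_replicate] at this
      omega
    have e : W m m m = ((0, true) :: (List.replicate m (1, true) ++ [(0, true)])) ++
          (List.replicate m (1, true) ++ ((0, true) :: (1, true) :: (0, false) ::
          (List.replicate m (1, false) ++ [(0, false), (1, true)]))) := by simp [W]
    have h1 : u <+: W m m m := ⟨v ++ x ++ y ++ z, by rw [hw]; simp⟩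
    have h2 : ((0, true) :: (List.replicate m (1, true) ++ [(0, true)])) <+: W m m m :=
      ⟨_, e.symm⟩
    obtain ⟨r, hr⟩ := List.prefix_of_prefix_length_le h2 h1 (by simp; omega)
    obtain ⟨m1, m2, n, ⟨e1, rfl⟩, ⟨e2, rfl⟩, ⟨e3, rfl⟩, e', hmem⟩ := hWi 3
    have hc := congrArg (List.count (1, false)) e'
    simp only [count_W, List.count_append, count_rep] at hc
    have hm1 : m = e1 + e1 := by
      rw [← hr] at e'
      simp only [W, List.cons_append, List.append_assoc, List.cons.injEq, true_and,
        List.nil_append] at e'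
      exact prefix_inj _ _ _ _ e'
    exact key1 hmem (by omega) (by omega)

end Final

end PP

theorem ppLanguage_not_contextFree : ¬ ppLanguage.IsContextFree :=
  PP.final
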